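/- Let B and H be Hopf algebras over a field k, let τ be an invertible skew pairing on (B,H), and let [τ] be the 2-cocycle [τ](b⊗g, c⊗h) = ε(b)τ(c,g)ε(h) on the tensor product Hopf algebra B ⊗ H. Then the multiplication of the twisted Hopf algebra (B ⊗ H)_{[τ]} is exactly the quantum double multiplication: (b⊗g) · (c⊗h) = Σ τ(c₁,g₁) bc₂ ⊗ g₂h τ⁻¹(c₃,g₃). In particular, the identity map is a Hopf algebra isomorphism from (B ⊗ H)_{[τ]} onto B ⋈_τ H. -/

import Mathlib

/-!
STATEMENT 4: The multiplication of the twisted Hopf algebra (B ⊗ H)_{[τ]} is exactly the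
quantum double multiplication: (b⊗g)·(c⊗h) = Σ τ(c₁,g₁) bc₂ ⊗ g₂h τ⁻¹(c₃,g₃).  In
particular, the identity map is a Hopf algebra isomorphism from (B ⊗ H)_{[τ]} onto B ⋈_τ H
(the two Hopf algebras share the same underlying coalgebra).
-/

open TensorProduct Coalgebra LinearMap

noncomputable section

variable {k : Type} [Field k]

/-- Convolution product of linear maps from a coalgebra `C` to an algebra `M`:
`(f * g)(c) = Σ f(c₁) g(c₂)`. -/
def conv {C M : Type} [AddCommGroup C] [Module k C] [Coalgebra k C]
    [Ring M] [Algebra k M] (f g : C →ₗ[k] M) : C →ₗ[k] M :=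
  (LinearMap.mul' k M) ∘ₗ (TensorProduct.map f g) ∘ₗ Coalgebra.comul

/-- A skew pairing on the ordered pair `(A, U)`. -/
structure IsSkewPairing {A U : Type} [Ring A] [Ring U] [HopfAlgebra k A] [HopfAlgebra k U]
    (τ : A ⊗[k] U →ₗ[k] k) : Prop where
  mul_left : ∀ (b c : A) (u : U),
    τ ((b * c) ⊗ₜ u) = conv (τ ∘ₗ TensorProduct.mk k A U b) (τ ∘ₗ TensorProduct.mk k A U c) u
  mul_right : ∀ (b : A) (u v : U),
    τ (b ⊗ₜ (u * v)) =
      conv (τ ∘ₗ (TensorProduct.mk k A U).flip v) (τ ∘ₗ (TensorProduct.mk k A U).flip u) b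
  one_left : ∀ u : U, τ (1 ⊗ₜ u) = Coalgebra.counit u
  one_right : ∀ a : A, τ (a ⊗ₜ 1) = Coalgebra.counit a

/-- The multiplication of the cocycle twist `A_σ`:
`x · y = Σ σ(x₁,y₁) x₂y₂ σ⁻¹(x₃,y₃)`, as a linear map `A ⊗ A → A`. -/
def twistMul {A : Type} [Ring A] [Algebra k A] [Coalgebra k A]
    (σ σi : A ⊗[k] A →ₗ[k] k) : A ⊗[k] A →ₗ[k] A :=
  conv (conv ((Algebra.linearMap k A) ∘ₗ σ) (LinearMap.mul' k A))
    ((Algebra.linearMap k A) ∘ₗ σi)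

variable {B H : Type} [Ring B] [Ring H] [HopfAlgebra k B] [HopfAlgebra k H]

/-- The bilinear form `[τ](b⊗g, c⊗h) = ε(b) τ(c,g) ε(h)` on `B ⊗ H`. -/
def bracket (τ : B ⊗[k] H →ₗ[k] k) : (B ⊗[k] H) ⊗[k] (B ⊗[k] H) →ₗ[k] k :=
  τ ∘ₗ
    TensorProduct.map
      ((TensorProduct.lid k B).toLinearMap ∘ₗ
        TensorProduct.map (Coalgebra.counit (R := k)) LinearMap.id)
      ((TensorProduct.rid k H).toLinearMap ∘ₗ
        TensorProduct.map LinearMap.id (Coalgebra.counit (R := k)))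
    ∘ₗ (TensorProduct.tensorTensorTensorComm k B H B H).toLinearMap

/-- The linear map `B ⊗ H → B ⊗ H`, `c ⊗ g ↦ Σ τ(c₁,g₁) (c₂ ⊗ g₂) τ⁻¹(c₃,g₃)`. -/
def doubleInner (τ τi : B ⊗[k] H →ₗ[k] k) : B ⊗[k] H →ₗ[k] B ⊗[k] H :=
  conv (conv ((Algebra.linearMap k (B ⊗[k] H)) ∘ₗ τ) LinearMap.id)
    ((Algebra.linearMap k (B ⊗[k] H)) ∘ₗ τi)

/-- A linear map `F` on `(B ⊗ H) ⊗ (B ⊗ H)` is induced by `K` on `B ⊗ H` when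
`F ((b ⊗ g) ⊗ (c ⊗ h)) = (b ⊗ 1) K(c ⊗ g) (1 ⊗ h)`. -/
def IsInducedBy (F : (B ⊗[k] H) ⊗[k] (B ⊗[k] H) →ₗ[k] B ⊗[k] H)
    (K : B ⊗[k] H →ₗ[k] B ⊗[k] H) : Prop :=
  ∀ (b c : B) (g h : H),
    F ((b ⊗ₜ g) ⊗ₜ (c ⊗ₜ h)) = (b ⊗ₜ (1 : H)) * K (c ⊗ₜ g) * ((1 : B) ⊗ₜ h)

lemma bracket_tmul (ρ : B ⊗[k] H →ₗ[k] k) (b c : B) (g h : H) :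
    bracket ρ ((b ⊗ₜ g) ⊗ₜ (c ⊗ₜ h)) = counit (R := k) b * counit (R := k) h * ρ (c ⊗ₜ g) := by
  simp [bracket, ← smul_tmul', mul_assoc, mul_left_comm]

lemma isInducedBy_mul' :
    IsInducedBy (LinearMap.mul' k (B ⊗[k] H)) (LinearMap.id : B ⊗[k] H →ₗ[k] B ⊗[k] H) := by
  intro b c g h
  simp

lemma conv_tmul_tmul {M : Type} [Ring M] [Algebra k M]
    (F G : (B ⊗[k] H) ⊗[k] (B ⊗[k] H) →ₗ[k] M) (b c : B) (g h : H) :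
    conv F G ((b ⊗ₜ g) ⊗ₜ (c ⊗ₜ h)) =
      LinearMap.mul' k M (TensorProduct.map F G
        (tensorTensorTensorComm k (B ⊗[k] H) (B ⊗[k] H) (B ⊗[k] H) (B ⊗[k] H)
          (tensorTensorTensorComm k B B H H (comul b ⊗ₜ comul g) ⊗ₜ
            tensorTensorTensorComm k B B H H (comul c ⊗ₜ comul h)))) := by
  rfl

lemma conv_tmul {M : Type} [Ring M] [Algebra k M]
    (F G : B ⊗[k] H →ₗ[k] M) (c : B) (g : H) :
    conv F G (c ⊗ₜ g) =
      LinearMap.mul' k M (TensorProduct.map F G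
        (tensorTensorTensorComm k B B H H (comul c ⊗ₜ comul g))) := by
  rfl

lemma IsInducedBy.conv_bracket {F : (B ⊗[k] H) ⊗[k] (B ⊗[k] H) →ₗ[k] B ⊗[k] H}
    {K : B ⊗[k] H →ₗ[k] B ⊗[k] H} (hF : IsInducedBy F K) (ρ : B ⊗[k] H →ₗ[k] k) :
    IsInducedBy (conv F (Algebra.linearMap k (B ⊗[k] H) ∘ₗ bracket ρ))
      (conv K (Algebra.linearMap k (B ⊗[k] H) ∘ₗ ρ)) := by
  have key (β κ : B ⊗[k] B) (γ η : H ⊗[k] H) :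
      LinearMap.mul' k _ (TensorProduct.map F (Algebra.linearMap k (B ⊗[k] H) ∘ₗ bracket ρ)
        (tensorTensorTensorComm k (B ⊗[k] H) (B ⊗[k] H) (B ⊗[k] H) (B ⊗[k] H)
          (tensorTensorTensorComm k B B H H (β ⊗ₜ γ) ⊗ₜ
            tensorTensorTensorComm k B B H H (κ ⊗ₜ η)))) =
      (TensorProduct.rid k B (counit.lTensor B β) ⊗ₜ (1 : H)) *
        LinearMap.mul' k _ (TensorProduct.map K (Algebra.linearMap k (B ⊗[k] H) ∘ₗ ρ)
          (tensorTensorTensorComm k B B H H (κ ⊗ₜ γ))) *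
        ((1 : B) ⊗ₜ TensorProduct.rid k H (counit.lTensor H η)) := by
    induction β with
    | zero => simp
    | add x y hx hy => simp only [add_tmul, map_add, hx, hy, add_mul]
    | tmul b₁ b₂ =>
    induction κ with
    | zero => simp
    | add x y hx hy => simp only [add_tmul, tmul_add, map_add, hx, hy, add_mul, mul_add]
    | tmul c₁ c₂ =>
    induction γ with
    | zero => simp
    | add x y hx hy => simp only [add_tmul, tmul_add, map_add, hx, hy, add_mul, mul_add]
    | tmul g₁ g₂ =>
    induction η with
    | zero => simp
    | add x y hx hy => simp only [tmul_add, map_add, hx, hy, mul_add]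
    | tmul h₁ h₂ =>
    simp only [tensorTensorTensorComm_tmul, map_tmul, LinearMap.comp_apply, bracket_tmul,
      hF b₁ c₁ g₁ h₁, mul'_apply, Algebra.linearMap_apply, lTensor_tmul, rid_tmul,
      Algebra.algebraMap_eq_smul_one, mul_smul_comm, mul_one, smul_mul_assoc, tmul_smul,
      ← smul_tmul', smul_smul, _root_.map_smul]
    congr 1
    ring
  intro b c g h
  rw [conv_tmul_tmul, conv_tmul, key]
  simp

lemma IsInducedBy.bracket_conv {F : (B ⊗[k] H) ⊗[k] (B ⊗[k] H) →ₗ[k] B ⊗[k] H}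
    {K : B ⊗[k] H →ₗ[k] B ⊗[k] H} (hF : IsInducedBy F K) (ρ : B ⊗[k] H →ₗ[k] k) :
    IsInducedBy (conv (Algebra.linearMap k (B ⊗[k] H) ∘ₗ bracket ρ) F)
      (conv (Algebra.linearMap k (B ⊗[k] H) ∘ₗ ρ) K) := by
  have key (β κ : B ⊗[k] B) (γ η : H ⊗[k] H) :
      LinearMap.mul' k _ (TensorProduct.map (Algebra.linearMap k (B ⊗[k] H) ∘ₗ bracket ρ) F
        (tensorTensorTensorComm k (B ⊗[k] H) (B ⊗[k] H) (B ⊗[k] H) (B ⊗[k] H)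
          (tensorTensorTensorComm k B B H H (β ⊗ₜ γ) ⊗ₜ
            tensorTensorTensorComm k B B H H (κ ⊗ₜ η)))) =
      (TensorProduct.lid k B (counit.rTensor B β) ⊗ₜ (1 : H)) *
        LinearMap.mul' k _ (TensorProduct.map (Algebra.linearMap k (B ⊗[k] H) ∘ₗ ρ) K
          (tensorTensorTensorComm k B B H H (κ ⊗ₜ γ))) *
        ((1 : B) ⊗ₜ TensorProduct.lid k H (counit.rTensor H η)) := by
    induction β with
    | zero => simp
    | add x y hx hy => simp only [add_tmul, map_add, hx, hy, add_mul]
    | tmul b₁ b₂ =>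
    induction κ with
    | zero => simp
    | add x y hx hy => simp only [add_tmul, tmul_add, map_add, hx, hy, add_mul, mul_add]
    | tmul c₁ c₂ =>
    induction γ with
    | zero => simp
    | add x y hx hy => simp only [add_tmul, tmul_add, map_add, hx, hy, add_mul, mul_add]
    | tmul g₁ g₂ =>
    induction η with
    | zero => simp
    | add x y hx hy => simp only [tmul_add, map_add, hx, hy, mul_add]
    | tmul h₁ h₂ =>
    simp only [tensorTensorTensorComm_tmul, map_tmul, LinearMap.comp_apply, bracket_tmul,
      hF b₂ c₂ g₂ h₂, mul'_apply, Algebra.linearMap_apply, rTensor_tmul, lid_tmul,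
      Algebra.algebraMap_eq_smul_one, mul_smul_comm, one_mul, smul_mul_assoc, tmul_smul,
      ← smul_tmul', smul_smul, _root_.map_smul]
    congr 1
    ring
  intro b c g h
  rw [conv_tmul_tmul, conv_tmul, key]
  simp

/-- the twisted multiplication of `(B ⊗ H)_{[τ]}` is the quantum double
multiplication `(b⊗g)·(c⊗h) = Σ τ(c₁,g₁) bc₂ ⊗ g₂h τ⁻¹(c₃,g₃)`. -/
theorem twist_eq_doubleMul (τ : B ⊗[k] H →ₗ[k] k) (hτ : IsSkewPairing τ)
    (τi : B ⊗[k] H →ₗ[k] k)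
    (hinv₁ : conv τ τi = Coalgebra.counit) (hinv₂ : conv τi τ = Coalgebra.counit) :
    ∀ (b c : B) (g h : H),
      twistMul (bracket τ) (bracket τi) ((b ⊗ₜ g) ⊗ₜ (c ⊗ₜ h))
        = (b ⊗ₜ (1 : H)) * doubleInner τ τi (c ⊗ₜ g) * ((1 : B) ⊗ₜ h) := by
  exact (isInducedBy_mul'.bracket_conv τ).conv_bracket τi

end
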